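/- arXiv:2003.03735 — 2 statements merged into one kernel-verified Lean document; each statement's English description precedes it below -/
import Mathlib

section
/- Let σ > 0 and let f and F be the density and distribution function of the Maxwell distribution MD(σ). Then as x → ∞ one has 1 − F(x) = σ²x⁻¹f(x)·[1 + σ²x⁻² − σ⁴x⁻⁴ + 3σ⁶x⁻⁶ + O(x⁻⁸)]; precisely, there exist constants C > 0 and X₀ > 0 such that for all x ≥ X₀, |(1 − F(x))·x/(σ²·f(x)) − (1 + σ²x⁻² − σ⁴x⁻⁴ + 3σ⁶x⁻⁶)| ≤ C·x⁻⁸. -/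
/-- Density of the Maxwell distribution MD(σ). -/
noncomputable def maxwellPdf (σ x : ℝ) : ℝ :=
  if 0 < x then Real.sqrt (2 / Real.pi) * x ^ 2 / σ ^ 3 * Real.exp (-(x ^ 2) / (2 * σ ^ 2)) else 0

/-- Distribution function of the Maxwell distribution MD(σ). -/
noncomputable def maxwellCdf (σ x : ℝ) : ℝ := ∫ u in (0:ℝ)..x, maxwellPdf σ u

open Real Set Filter Topology MeasureTheory

theorem nonpos_of_hasDerivAt_nonneg_of_tendsto_zero {D D' : ℝ → ℝ} {a : ℝ}
    (hD : ∀ x, a < x → HasDerivAt D (D' x) x) (hD' : ∀ x, a < x → 0 ≤ D' x)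
    (hlim : Tendsto D atTop (𝓝 0)) {x : ℝ} (hx : a < x) : D x ≤ 0 := by
  have hmono : MonotoneOn D (Ioi a) := by
    refine monotoneOn_of_hasDerivWithinAt_nonneg (f' := D') (convex_Ioi a)
      (fun y hy => (hD y hy).continuousAt.continuousWithinAt) ?_ ?_
    · intro y hy
      rw [interior_Ioi] at hy
      exact (hD y hy).hasDerivWithinAt
    · intro y hy
      rw [interior_Ioi] at hy
      exact hD' y hy
  refine ge_of_tendsto hlim ?_
  filter_upwards [eventually_ge_atTop x] with y hy
  exact hmono hx (hx.trans_le hy) hy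

theorem hasDerivAt_exp_neg_sq_div (σ x : ℝ) :
    HasDerivAt (fun u : ℝ => exp (-(u ^ 2) / (2 * σ ^ 2)))
      (exp (-(x ^ 2) / (2 * σ ^ 2)) * (-(2 * x) / (2 * σ ^ 2))) x := by
  simpa using (((hasDerivAt_pow 2 x).neg).div_const (2 * σ ^ 2)).exp

theorem tendsto_mul_exp_neg_sq_div {σ : ℝ} (hσ : 0 < σ) :
    Tendsto (fun x : ℝ => x * exp (-(x ^ 2) / (2 * σ ^ 2))) atTop (𝓝 0) := by
  have h := rpow_mul_exp_neg_mul_sq_isLittleO_exp_neg (b := 1 / (2 * σ ^ 2)) (by positivity) 1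
  have h0 : Tendsto (fun x : ℝ => exp (-(1 / 2) * x)) atTop (𝓝 0) :=
    tendsto_exp_atBot.comp (tendsto_id.const_mul_atTop_of_neg (by norm_num))
  refine (h.trans_tendsto h0).congr fun x => ?_
  rw [rpow_one]
  congr 2
  ring

theorem integrable_exp_neg_sq_div {σ : ℝ} (hσ : 0 < σ) :
    Integrable fun x : ℝ => exp (-(x ^ 2) / (2 * σ ^ 2)) := by
  refine (integrable_exp_neg_mul_sq (b := 1 / (2 * σ ^ 2)) (by positivity)).congr
    (ae_of_all _ fun x => ?_)
  dsimp only
  congr 1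
  ring

theorem integrable_sq_mul_exp_neg_sq_div {σ : ℝ} (hσ : 0 < σ) :
    Integrable fun x : ℝ => x ^ 2 * exp (-(x ^ 2) / (2 * σ ^ 2)) := by
  refine (integrable_rpow_mul_exp_neg_mul_sq (b := 1 / (2 * σ ^ 2)) (by positivity)
    (s := 2) (by norm_num)).congr (ae_of_all _ fun x => ?_)
  dsimp only
  rw [rpow_two]
  congr 2
  ring

theorem integral_Ioi_sq_mul_exp_neg_sq_div {σ : ℝ} (hσ : 0 < σ) :
    ∫ x in Ioi (0 : ℝ), x ^ 2 * exp (-(x ^ 2) / (2 * σ ^ 2)) =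
      σ ^ 2 * (√(π * (2 * σ ^ 2)) / 2) := by
  have hgauss : ∫ x in Ioi (0 : ℝ), exp (-(x ^ 2) / (2 * σ ^ 2)) = √(π * (2 * σ ^ 2)) / 2 := by
    have h := integral_gaussian_Ioi (1 / (2 * σ ^ 2))
    rw [div_div_eq_mul_div, div_one] at h
    rw [← h]
    congr 1
    ext x
    congr 1
    ring
  have hparts : ∫ x in Ioi (0 : ℝ), (x ^ 2 * exp (-(x ^ 2) / (2 * σ ^ 2)) -
      σ ^ 2 * exp (-(x ^ 2) / (2 * σ ^ 2))) = 0 := by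
    have h := integral_Ioi_of_hasDerivAt_of_tendsto' (a := (0 : ℝ)) (m := 0)
      (f := fun x => -σ ^ 2 * (x * exp (-(x ^ 2) / (2 * σ ^ 2))))
      (f' := fun x => x ^ 2 * exp (-(x ^ 2) / (2 * σ ^ 2)) -
        σ ^ 2 * exp (-(x ^ 2) / (2 * σ ^ 2)))
      (fun x _ => by
        refine (((hasDerivAt_id' x).mul (hasDerivAt_exp_neg_sq_div σ x)).const_mul
          (-σ ^ 2)).congr_deriv ?_
        field_simp
        ring)
      ((integrable_sq_mul_exp_neg_sq_div hσ).sub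
        ((integrable_exp_neg_sq_div hσ).const_mul _)).integrableOn
      (by simpa using (tendsto_mul_exp_neg_sq_div hσ).const_mul (-σ ^ 2))
    simpa using h
  rw [integral_sub (integrable_sq_mul_exp_neg_sq_div hσ).integrableOn
    ((integrable_exp_neg_sq_div hσ).const_mul _).integrableOn, integral_const_mul, hgauss,
    sub_eq_zero] at hparts
  exact hparts

theorem maxwellPdf_of_nonneg (σ : ℝ) {x : ℝ} (hx : 0 ≤ x) :
    maxwellPdf σ x = √(2 / π) / σ ^ 3 * (x ^ 2 * exp (-(x ^ 2) / (2 * σ ^ 2))) := by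
  rcases hx.eq_or_lt with rfl | hx
  · simp [maxwellPdf]
  · rw [maxwellPdf, if_pos hx]
    ring

theorem maxwellCdf_of_nonneg (σ : ℝ) {x : ℝ} (hx : 0 ≤ x) :
    maxwellCdf σ x =
      √(2 / π) / σ ^ 3 * ∫ u in (0 : ℝ)..x, u ^ 2 * exp (-(u ^ 2) / (2 * σ ^ 2)) := by
  rw [maxwellCdf, ← intervalIntegral.integral_const_mul]
  refine intervalIntegral.integral_congr fun u hu => ?_
  rw [uIcc_of_le hx] at hu
  exact maxwellPdf_of_nonneg σ hu.1

theorem hasDerivAt_maxwellCdf (σ : ℝ) {x : ℝ} (hx : 0 < x) :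
    HasDerivAt (maxwellCdf σ) (maxwellPdf σ x) x := by
  have hcont : Continuous fun u : ℝ => u ^ 2 * exp (-(u ^ 2) / (2 * σ ^ 2)) := by fun_prop
  rw [maxwellPdf_of_nonneg σ hx.le]
  refine ((hcont.integral_hasStrictDerivAt 0 x).hasDerivAt.const_mul
    (√(2 / π) / σ ^ 3)).congr_of_eventuallyEq ?_
  filter_upwards [eventually_gt_nhds hx] with y hy
  exact maxwellCdf_of_nonneg σ hy.le

theorem tendsto_maxwellCdf_atTop {σ : ℝ} (hσ : 0 < σ) :
    Tendsto (maxwellCdf σ) atTop (𝓝 1) := by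
  have h := (intervalIntegral_tendsto_integral_Ioi 0
    (integrable_sq_mul_exp_neg_sq_div hσ).integrableOn tendsto_id).const_mul (√(2 / π) / σ ^ 3)
  rw [integral_Ioi_sq_mul_exp_neg_sq_div hσ] at h
  have hsqrt : √(2 / π) * √(π * (2 * σ ^ 2)) = 2 * σ := by
    rw [← sqrt_mul (by positivity), show 2 / π * (π * (2 * σ ^ 2)) = (2 * σ) ^ 2 by
      field_simp, sqrt_sq (by positivity)]
  have hone : √(2 / π) / σ ^ 3 * (σ ^ 2 * (√(π * (2 * σ ^ 2)) / 2)) = 1 := by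
    calc _ = √(2 / π) * √(π * (2 * σ ^ 2)) / (2 * σ) := by field_simp
      _ = 1 := by rw [hsqrt]; field_simp
  rw [hone] at h
  refine h.congr' ?_
  filter_upwards [eventually_ge_atTop 0] with x hx
  exact (maxwellCdf_of_nonneg σ hx).symm

/-- The tail expansion of the Maxwell distribution to third order, with an arbitrary
coefficient `c` in the fourth-order term. -/
noncomputable def maxwellTailApprox (σ c x : ℝ) : ℝ :=
  √(2 / π) / σ * (x * exp (-(x ^ 2) / (2 * σ ^ 2))) *
    (1 + σ ^ 2 / x ^ 2 - σ ^ 4 / x ^ 4 + 3 * σ ^ 6 / x ^ 6 + c * σ ^ 8 / x ^ 8)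

theorem hasDerivAt_maxwellTailApprox {σ : ℝ} (hσ : 0 < σ) (c : ℝ) {x : ℝ} (hx : 0 < x) :
    HasDerivAt (maxwellTailApprox σ c)
      (-maxwellPdf σ x - √(2 / π) / σ ^ 3 * exp (-(x ^ 2) / (2 * σ ^ 2)) *
        ((c + 15) * σ ^ 8 / x ^ 6 + 7 * c * σ ^ 10 / x ^ 8)) x := by
  have hdiv (k : ℝ) (n : ℕ) :
      HasDerivAt (fun u : ℝ => k / u ^ n) (-(k * (n * x ^ (n - 1))) / (x ^ n) ^ 2) x := by
    refine ((hasDerivAt_const x k).div (hasDerivAt_pow n x) (pow_ne_zero n hx.ne')).congr_deriv ?_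
    rw [zero_mul, zero_sub, neg_div]
  have hseries := (((((hasDerivAt_const x (1 : ℝ)).add (hdiv (σ ^ 2) 2)).sub
    (hdiv (σ ^ 4) 4)).add (hdiv (3 * σ ^ 6) 6)).add (hdiv (c * σ ^ 8) 8))
  refine ((((hasDerivAt_id' x).mul (hasDerivAt_exp_neg_sq_div σ x)).const_mul
    (√(2 / π) / σ)).mul hseries).congr_deriv ?_
  rw [maxwellPdf_of_nonneg σ hx.le]
  simp only [Pi.add_apply, Pi.sub_apply, Pi.mul_apply]
  generalize exp (-(x ^ 2) / (2 * σ ^ 2)) = e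
  push_cast
  field_simp
  ring

theorem tendsto_maxwellTailApprox_atTop {σ : ℝ} (hσ : 0 < σ) (c : ℝ) :
    Tendsto (maxwellTailApprox σ c) atTop (𝓝 0) := by
  have hdiv (k : ℝ) {n : ℕ} (hn : n ≠ 0) : Tendsto (fun x : ℝ => k / x ^ n) atTop (𝓝 0) :=
    tendsto_const_nhds.div_atTop (tendsto_pow_atTop hn)
  have hseries := ((((tendsto_const_nhds (x := (1 : ℝ))).add (hdiv (σ ^ 2) two_ne_zero)).sub
    (hdiv (σ ^ 4) four_ne_zero)).add (hdiv (3 * σ ^ 6) (n := 6) (by norm_num))).add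
    (hdiv (c * σ ^ 8) (n := 8) (by norm_num))
  have h := ((tendsto_mul_exp_neg_sq_div hσ).const_mul (√(2 / π) / σ)).mul hseries
  rwa [mul_zero, zero_mul] at h

theorem maxwellTailApprox_eq_mul_maxwellPdf {σ : ℝ} (hσ : 0 < σ) (c : ℝ) {x : ℝ} (hx : 0 < x) :
    maxwellTailApprox σ c x = σ ^ 2 * maxwellPdf σ x / x *
      (1 + σ ^ 2 / x ^ 2 - σ ^ 4 / x ^ 4 + 3 * σ ^ 6 / x ^ 6 + c * σ ^ 8 / x ^ 8) := by
  rw [maxwellTailApprox, maxwellPdf_of_nonneg σ hx.le]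
  congr 1
  field_simp

theorem hasDerivAt_maxwellTail_sub_approx {σ : ℝ} (hσ : 0 < σ) (c : ℝ) {x : ℝ} (hx : 0 < x) :
    HasDerivAt (fun u => 1 - maxwellCdf σ u - maxwellTailApprox σ c u)
      (√(2 / π) / σ ^ 3 * exp (-(x ^ 2) / (2 * σ ^ 2)) *
        ((c + 15) * σ ^ 8 / x ^ 6 + 7 * c * σ ^ 10 / x ^ 8)) x :=
  (((hasDerivAt_maxwellCdf σ hx).const_sub 1).sub
    (hasDerivAt_maxwellTailApprox hσ c hx)).congr_deriv (by ring)

theorem tendsto_maxwellTail_sub_approx {σ : ℝ} (hσ : 0 < σ) (c : ℝ) :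
    Tendsto (fun u => 1 - maxwellCdf σ u - maxwellTailApprox σ c u) atTop (𝓝 0) := by
  simpa using ((tendsto_maxwellCdf_atTop hσ).const_sub 1).sub
    (tendsto_maxwellTailApprox_atTop hσ c)

theorem maxwellTail_le_approx {σ c : ℝ} (hσ : 0 < σ) (hc : 0 ≤ c) {x : ℝ} (hx : 0 < x) :
    1 - maxwellCdf σ x ≤ maxwellTailApprox σ c x :=
  sub_nonpos.1 <| nonpos_of_hasDerivAt_nonneg_of_tendsto_zero
    (fun _ hy => hasDerivAt_maxwellTail_sub_approx hσ c hy)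
    (fun _ hy => by have : (0 : ℝ) < _ := hy; positivity)
    (tendsto_maxwellTail_sub_approx hσ c) hx

theorem approx_le_maxwellTail {σ c : ℝ} (hσ : 0 < σ) (hc : c ≤ -15) {x : ℝ} (hx : 0 < x) :
    maxwellTailApprox σ c x ≤ 1 - maxwellCdf σ x := by
  refine sub_nonneg.1 <| neg_nonpos.1 <| nonpos_of_hasDerivAt_nonneg_of_tendsto_zero
    (fun _ hy => (hasDerivAt_maxwellTail_sub_approx hσ c hy).neg) (fun y hy => ?_)
    (neg_zero (G := ℝ) ▸ (tendsto_maxwellTail_sub_approx hσ c).neg) hx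
  rw [← mul_neg, neg_add, ← neg_div, ← neg_div, ← neg_mul, ← neg_mul, ← mul_neg]
  have h₁ : 0 ≤ -(c + 15) := by linarith
  have h₂ : 0 ≤ -c := by linarith
  positivity

/-- Lemma 2.1: tail expansion of the Maxwell distribution function. -/
theorem maxwell_tail_expansion (σ : ℝ) (hσ : 0 < σ) :
    ∃ C > (0:ℝ), ∃ X₀ > (0:ℝ), ∀ x ≥ X₀,
      |(1 - maxwellCdf σ x) * x / (σ ^ 2 * maxwellPdf σ x)
        - (1 + σ ^ 2 / x ^ 2 - σ ^ 4 / x ^ 4 + 3 * σ ^ 6 / x ^ 6)| ≤ C / x ^ 8 := by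
  refine ⟨15 * σ ^ 8, by positivity, 1, one_pos, fun x hx => ?_⟩
  have hx0 : 0 < x := one_pos.trans_le hx
  have hf : 0 < maxwellPdf σ x := by
    rw [maxwellPdf_of_nonneg σ hx0.le]
    positivity
  have hq : 0 < σ ^ 2 * maxwellPdf σ x / x := by positivity
  have hupper := maxwellTail_le_approx hσ le_rfl hx0
  have hlower := approx_le_maxwellTail hσ le_rfl hx0
  rw [maxwellTailApprox_eq_mul_maxwellPdf hσ _ hx0] at hupper hlower
  rw [← div_le_iff₀' hq, div_div_eq_mul_div] at hupper
  rw [← le_div_iff₀' hq, div_div_eq_mul_div] at hlower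
  have hnonneg : 0 ≤ 15 * σ ^ 8 / x ^ 8 := by positivity
  rw [zero_mul, zero_div] at hupper
  rw [neg_mul, neg_div] at hlower
  rw [abs_le]
  constructor <;> linarith
end

section
/- Let σ > 0 and let F be the distribution function of MD(σ). Define â_n = σ/(2 log n)^{1/2} and b̂_n = (2σ² log n)^{1/2} + σ·(log(2 log n) + log(2/π))/(2·(2 log n)^{1/2}). Then for every real x, lim_{n→∞} [Fⁿ(â_n x + b̂_n) − Λ(x)] / [Λ(x)·e^{−x}·(log(2 log n))²/(16 log n)] = 1, where Λ(x) = exp(−exp(−x)). -/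
open Filter Topology MeasureTheory Set

/-- If `n * q n = a + d * ε n + o(ε n)` then `(1 - q n) ^ n = exp (-a) * (1 - d * ε n + o(ε n))`. -/
theorem tendsto_one_sub_pow_sub_exp_div {q ε : ℕ → ℝ} {a d : ℝ}
    (hε : ∀ᶠ n in atTop, 0 < ε n) (hε0 : Tendsto ε atTop (𝓝 0))
    (hnε : Tendsto (fun n : ℕ => n * ε n) atTop atTop)
    (h : Tendsto (fun n : ℕ => (n * q n - a) / ε n) atTop (𝓝 d)) :
    Tendsto (fun n : ℕ => ((1 - q n) ^ n - Real.exp (-a)) / ε n) atTop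
      (𝓝 (-(Real.exp (-a) * d))) := by
  have hnq : Tendsto (fun n : ℕ => n * q n) atTop (𝓝 a) := by
    have h1 := (h.mul hε0).add_const a
    simp only [mul_zero, zero_add] at h1
    refine h1.congr' ?_
    filter_upwards [hε] with n hn
    field_simp
    ring
  have hq : Tendsto q atTop (𝓝 0) := by
    have h1 := hnq.div_atTop tendsto_natCast_atTop_atTop
    refine h1.congr' ?_
    filter_upwards [eventually_gt_atTop 0] with n hn
    have : (n : ℝ) ≠ 0 := by positivity
    field_simp
  have hlog : Tendsto (fun n : ℕ => n * (Real.log (1 - q n) + q n) / ε n) atTop (𝓝 0) := by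
    have hlow : Tendsto (fun n : ℕ => -(2 * ((n * q n) ^ 2 / (n * ε n)))) atTop (𝓝 0) := by
      simpa using (((hnq.pow 2).div_atTop hnε).const_mul 2).neg
    refine tendsto_of_tendsto_of_tendsto_of_le_of_le' hlow tendsto_const_nhds ?_ ?_
    · filter_upwards [hε, eventually_gt_atTop 0, hq.eventually_lt_const one_half_pos]
        with n hn hn0 hqn
      have hn0' : (0 : ℝ) < n := by exact_mod_cast hn0
      have h1 := Real.one_sub_inv_le_log_of_pos (show 0 < 1 - q n by linarith)
      have h2 : -(2 * q n ^ 2) ≤ Real.log (1 - q n) + q n := by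
        have h3 : 1 - (1 - q n)⁻¹ + q n = -(q n ^ 2 / (1 - q n)) := by
          have : 1 - q n ≠ 0 := by linarith
          field_simp
          ring
        have h4 : q n ^ 2 / (1 - q n) ≤ 2 * q n ^ 2 := by
          rw [div_le_iff₀ (by linarith)]
          nlinarith [sq_nonneg (q n)]
        linarith
      have h5 : -(2 * ((n * q n) ^ 2 / (n * ε n))) = n * (-(2 * q n ^ 2)) / ε n := by
        field_simp
      rw [h5]
      gcongr
    · filter_upwards [hε, hq.eventually_lt_const one_half_pos] with n hn hqn
      have h1 := Real.log_le_sub_one_of_pos (show 0 < 1 - q n by linarith)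
      exact div_nonpos_of_nonpos_of_nonneg
        (mul_nonpos_of_nonneg_of_nonpos (by positivity) (by linarith)) hn.le
  have hw : Tendsto (fun n : ℕ => (n * Real.log (1 - q n) + a) / ε n) atTop (𝓝 (-d)) := by
    have h1 := hlog.sub h
    rw [zero_sub] at h1
    refine h1.congr fun n => ?_
    ring
  have hw0 : Tendsto (fun n : ℕ => n * Real.log (1 - q n)) atTop (𝓝 (-a)) := by
    have h1 := (hw.mul hε0).sub_const a
    simp only [mul_zero, zero_sub] at h1
    refine h1.congr' ?_
    filter_upwards [hε] with n hn
    field_simp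
    ring
  have hslope : Tendsto (fun n : ℕ => dslope Real.exp (-a) (n * Real.log (1 - q n)))
      atTop (𝓝 (Real.exp (-a))) := by
    have h1 : ContinuousAt (dslope Real.exp (-a)) (-a) :=
      continuousAt_dslope_same.2 Real.differentiableAt_exp
    have h2 := h1.tendsto.comp hw0
    rwa [dslope_same, Real.deriv_exp] at h2
  have h1 := hslope.mul hw
  rw [mul_neg] at h1
  refine h1.congr' ?_
  filter_upwards [hq.eventually_lt_const one_half_pos] with n hqn
  have h2 := sub_smul_dslope Real.exp (-a) (n * Real.log (1 - q n))
  have h3 : Real.exp (n * Real.log (1 - q n)) = (1 - q n) ^ n := by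
    rw [Real.exp_nat_mul, Real.exp_log (by linarith)]
  rw [h3, smul_eq_mul, sub_neg_eq_add] at h2
  rw [← h2]
  ring

theorem integrable_exp_neg_sq_div_two : Integrable fun s : ℝ => Real.exp (-s ^ 2 / 2) := by
  refine (integrable_exp_neg_mul_sq one_half_pos).congr (.of_forall fun s => ?_)
  simp only
  ring_nf

theorem hasDerivAt_exp_neg_sq_div_two (s : ℝ) :
    HasDerivAt (fun s : ℝ => Real.exp (-s ^ 2 / 2)) (-(s * Real.exp (-s ^ 2 / 2))) s := by
  have h := (((hasDerivAt_id s).pow 2).neg.div_const 2).exp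
  refine h.congr_deriv ?_
  simp
  ring

/-- Mills-ratio bound for the Gaussian tail. -/
theorem integral_Ioi_exp_neg_sq_div_two_le {z : ℝ} (hz : 0 < z) :
    ∫ s in Ioi z, Real.exp (-s ^ 2 / 2) ≤ Real.exp (-z ^ 2 / 2) / z := by
  have hder : ∀ s ∈ Ici z, HasDerivAt (fun s : ℝ => -(Real.exp (-s ^ 2 / 2) / z))
      (s * Real.exp (-s ^ 2 / 2) / z) s := fun s _ => by
    refine ((hasDerivAt_exp_neg_sq_div_two s).div_const z).neg.congr_deriv ?_
    ring
  have hpos : ∀ s ∈ Ioi z, 0 ≤ s * Real.exp (-s ^ 2 / 2) / z := fun s hs => by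
    have : 0 < s := hz.trans hs
    positivity
  have hlim : Tendsto (fun s : ℝ => -(Real.exp (-s ^ 2 / 2) / z)) atTop (𝓝 0) := by
    have h1 : Tendsto (fun s : ℝ => -s ^ 2 / 2) atTop atBot := by
      have := (tendsto_pow_atTop (α := ℝ) two_ne_zero).atTop_div_const two_pos
      refine (tendsto_neg_atTop_atBot.comp this).congr fun s => ?_
      simp [neg_div]
    simpa using ((Real.tendsto_exp_atBot.comp h1).div_const z).neg
  have hint := integrableOn_Ioi_deriv_of_nonneg' hder hpos hlim
  have hval := integral_Ioi_of_hasDerivAt_of_nonneg' hder hpos hlim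
  calc ∫ s in Ioi z, Real.exp (-s ^ 2 / 2)
      ≤ ∫ s in Ioi z, s * Real.exp (-s ^ 2 / 2) / z := by
        refine setIntegral_mono_on integrable_exp_neg_sq_div_two.integrableOn hint
          measurableSet_Ioi fun s hs => ?_
        rw [le_div_iff₀ hz, mul_comm]
        exact mul_le_mul_of_nonneg_right (le_of_lt hs) (Real.exp_pos _).le
    _ = Real.exp (-z ^ 2 / 2) / z := by rw [hval]; ring

theorem one_sub_maxwellCdf {σ z : ℝ} (hσ : 0 < σ) (hz : 0 ≤ z) :
    1 - maxwellCdf σ (σ * z) = Real.sqrt (2 / Real.pi) *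
      (z * Real.exp (-z ^ 2 / 2) + ∫ s in Ioi z, Real.exp (-s ^ 2 / 2)) := by
  have hcont : Continuous fun s : ℝ => Real.exp (-s ^ 2 / 2) := by fun_prop
  have hcdf : maxwellCdf σ (σ * z) = Real.sqrt (2 / Real.pi) *
      ((∫ s in (0:ℝ)..z, Real.exp (-s ^ 2 / 2)) - z * Real.exp (-z ^ 2 / 2)) := by
    have h1 : maxwellCdf σ (σ * z) =
        ∫ u in (0:ℝ)..σ * z, σ⁻¹ * (Real.sqrt (2 / Real.pi) *
          ((u / σ) ^ 2 * Real.exp (-(u / σ) ^ 2 / 2))) := by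
      refine intervalIntegral.integral_congr fun u hu => ?_
      rw [uIcc_of_le (by positivity)] at hu
      rcases hu.1.eq_or_lt with rfl | h
      · simp [maxwellPdf]
      · simp only [maxwellPdf, if_pos h]
        rw [show -(u / σ) ^ 2 / 2 = -(u ^ 2) / (2 * σ ^ 2) by field_simp]
        field_simp
    rw [h1, intervalIntegral.integral_const_mul,
      intervalIntegral.integral_comp_div (fun v => Real.sqrt (2 / Real.pi) *
          (v ^ 2 * Real.exp (-v ^ 2 / 2))) hσ.ne', zero_div, mul_div_cancel_left₀ _ hσ.ne',
      smul_eq_mul, inv_mul_cancel_left₀ hσ.ne', intervalIntegral.integral_const_mul]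
    congr 1
    rw [eq_sub_iff_add_eq, ← eq_sub_iff_add_eq', ← intervalIntegral.integral_sub
      (hcont.intervalIntegrable _ _) ((by fun_prop : Continuous fun v : ℝ =>
        v ^ 2 * Real.exp (-v ^ 2 / 2)).intervalIntegrable _ _)]
    rw [intervalIntegral.integral_eq_sub_of_hasDerivAt
      (f := fun v : ℝ => v * Real.exp (-v ^ 2 / 2))]
    · simp
    · intro v _
      refine ((hasDerivAt_id v).mul (hasDerivAt_exp_neg_sq_div_two v)).congr_deriv ?_
      simp
      ring
    · exact (by fun_prop : Continuous fun v : ℝ =>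
        Real.exp (-v ^ 2 / 2) - v ^ 2 * Real.exp (-v ^ 2 / 2)).intervalIntegrable _ _
  have htot : Real.sqrt (2 / Real.pi) * ((∫ s in (0:ℝ)..z, Real.exp (-s ^ 2 / 2)) +
      ∫ s in Ioi z, Real.exp (-s ^ 2 / 2)) = 1 := by
    rw [intervalIntegral.integral_interval_add_Ioi
      integrable_exp_neg_sq_div_two.integrableOn integrable_exp_neg_sq_div_two.integrableOn]
    have h1 := integral_gaussian_Ioi (1 / 2)
    have h2 : (fun s : ℝ => Real.exp (-s ^ 2 / 2)) = fun s => Real.exp (-(1 / 2) * s ^ 2) := by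
      ext s; ring_nf
    have hpi := Real.pi_pos
    have h3 : Real.pi / (1 / 2) = 2 ^ 2 * (2 / Real.pi)⁻¹ := by field_simp
    rw [h2, h1, h3, Real.sqrt_mul (by positivity), Real.sqrt_sq (by norm_num), Real.sqrt_inv]
    have : Real.sqrt (2 / Real.pi) ≠ 0 := by positivity
    field_simp
  rw [hcdf, ← htot]
  ring

/-- The centred normalisation `x + (log (2L) + log (2/π)) / 2`. -/
noncomputable def maxwellShift (x L : ℝ) : ℝ :=
  x + (Real.log (2 * L) + Real.log (2 / Real.pi)) / 2

/-- The normalised threshold at level `L = log n`, for unit scale. -/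
noncomputable def maxwellThreshold (x L : ℝ) : ℝ :=
  Real.sqrt (2 * L) + maxwellShift x L / Real.sqrt (2 * L)

/-- Ratio of the Gaussian tail integral to the leading term of the Maxwell tail. -/
noncomputable def maxwellTailRemainder (z : ℝ) : ℝ :=
  (∫ s in Ioi z, Real.exp (-s ^ 2 / 2)) / (z * Real.exp (-z ^ 2 / 2))

theorem maxwellTailRemainder_nonneg {z : ℝ} (hz : 0 < z) : 0 ≤ maxwellTailRemainder z :=
  div_nonneg (integral_nonneg fun _ => (Real.exp_pos _).le) (by positivity)

theorem maxwellTailRemainder_le {z : ℝ} (hz : 0 < z) : maxwellTailRemainder z ≤ 1 / z ^ 2 := by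
  rw [maxwellTailRemainder, div_le_iff₀ (by positivity)]
  refine (integral_Ioi_exp_neg_sq_div_two_le hz).trans_eq ?_
  field_simp

theorem exp_mul_one_sub_maxwellCdf {σ x L : ℝ} (hσ : 0 < σ) (hL : 0 < L)
    (hz : 0 < maxwellThreshold x L) :
    Real.exp L * (1 - maxwellCdf σ (σ * maxwellThreshold x L)) =
      Real.exp (-x) * ((1 + maxwellShift x L / (2 * L)) *
        (1 + maxwellTailRemainder (maxwellThreshold x L)) *
        Real.exp (-(maxwellShift x L ^ 2 / (4 * L)))) := by
  set t := Real.sqrt (2 * L) with ht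
  set y := maxwellShift x L with hy
  set z := maxwellThreshold x L with hz'
  have htpos : 0 < t := Real.sqrt_pos.2 (by positivity)
  have htsq : t ^ 2 = 2 * L := Real.sq_sqrt (by positivity)
  have hzt : z = t + y / t := rfl
  have hzsq : -z ^ 2 / 2 = -L + -y + -(y ^ 2 / (4 * L)) := by
    have hL2 : L = t ^ 2 / 2 := by linarith
    rw [hzt, hL2]
    field_simp
    ring
  have hzdiv : z = t * (1 + y / (2 * L)) := by
    rw [hzt, ← htsq]
    field_simp
  have hexpy : Real.exp (-y) * (t * Real.sqrt (2 / Real.pi)) = Real.exp (-x) := by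
    have h1 : Real.exp (Real.log (2 * L) / 2) = t := by
      rw [Real.exp_half, Real.exp_log (by positivity)]
    have h2 : Real.exp (Real.log (2 / Real.pi) / 2) = Real.sqrt (2 / Real.pi) := by
      rw [Real.exp_half, Real.exp_log (by positivity)]
    rw [← h1, ← h2, ← Real.exp_add, ← Real.exp_add]
    congr 1
    rw [hy, maxwellShift]
    ring
  have htail : (∫ s in Ioi z, Real.exp (-s ^ 2 / 2)) =
      maxwellTailRemainder z * (z * Real.exp (-z ^ 2 / 2)) := by
    rw [maxwellTailRemainder, div_mul_cancel₀]
    positivity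
  have hLL : Real.exp L * Real.exp (-L) = 1 := by rw [← Real.exp_add]; simp
  rw [one_sub_maxwellCdf hσ hz.le, htail, ← hexpy]
  calc _ = Real.exp L * (Real.sqrt (2 / Real.pi) *
        (z * Real.exp (-z ^ 2 / 2) * (1 + maxwellTailRemainder z))) := by ring
    _ = (Real.exp L * Real.exp (-L)) * (Real.sqrt (2 / Real.pi) *
        (t * (1 + y / (2 * L)) * (Real.exp (-y) * Real.exp (-(y ^ 2 / (4 * L)))) *
          (1 + maxwellTailRemainder z))) := by
        rw [hzsq, Real.exp_add, Real.exp_add]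
        nth_rewrite 1 [hzdiv]
        ring
    _ = _ := by rw [hLL]; ring

theorem tendsto_log_two_mul_atTop : Tendsto (fun L : ℝ => Real.log (2 * L)) atTop atTop :=
  Real.tendsto_log_atTop.comp (tendsto_id.const_mul_atTop two_pos)

theorem tendsto_log_two_mul_sq_div :
    Tendsto (fun L : ℝ => Real.log (2 * L) ^ 2 / (16 * L)) atTop (𝓝 0) := by
  have h1 := (Real.isLittleO_pow_log_id_atTop (n := 2)).tendsto_div_nhds_zero.comp
    (tendsto_id.const_mul_atTop (two_pos (α := ℝ)))
  have h2 := h1.div_const 8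
  rw [zero_div] at h2
  refine h2.congr fun L => ?_
  simp only [Function.comp_apply, id]
  rw [div_div]
  ring_nf

theorem tendsto_maxwellShift_div_log (x : ℝ) :
    Tendsto (fun L => maxwellShift x L / Real.log (2 * L)) atTop (𝓝 (1 / 2)) := by
  have h1 := (tendsto_const_nhds (x := x + Real.log (2 / Real.pi) / 2)).div_atTop
    tendsto_log_two_mul_atTop
  have h2 := h1.add_const (1 / 2)
  rw [zero_add] at h2
  refine h2.congr' ?_
  filter_upwards [tendsto_log_two_mul_atTop.eventually_gt_atTop 0] with L hL
  rw [maxwellShift]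
  field_simp
  ring

theorem tendsto_maxwellShift_atTop (x : ℝ) : Tendsto (maxwellShift x) atTop atTop :=
  tendsto_atTop_add_const_left _ _
    ((tendsto_atTop_add_const_right _ _ tendsto_log_two_mul_atTop).atTop_div_const two_pos)

theorem eventually_sqrt_le_maxwellThreshold (x : ℝ) :
    ∀ᶠ L in atTop, Real.sqrt (2 * L) ≤ maxwellThreshold x L := by
  filter_upwards [(tendsto_maxwellShift_atTop x).eventually_ge_atTop 0] with L hL
  exact le_add_of_nonneg_right (by positivity)

/-- Second-order expansion of the normalised Maxwell tail. -/
theorem tendsto_exp_mul_one_sub_maxwellCdf_sub_div {σ : ℝ} (hσ : 0 < σ) (x : ℝ) :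
    Tendsto (fun L => (Real.exp L * (1 - maxwellCdf σ (σ * maxwellThreshold x L)) - Real.exp (-x)) /
      (Real.log (2 * L) ^ 2 / (16 * L))) atTop (𝓝 (-Real.exp (-x))) := by
  set ε : ℝ → ℝ := fun L => Real.log (2 * L) ^ 2 / (16 * L) with hε
  set s : ℝ → ℝ := fun L => maxwellShift x L / (2 * L) with hs
  set r : ℝ → ℝ := fun L => maxwellShift x L ^ 2 / (4 * L) with hr
  set δ : ℝ → ℝ := fun L => maxwellTailRemainder (maxwellThreshold x L) with hδ
  have hε0 : Tendsto ε atTop (𝓝 0) := tendsto_log_two_mul_sq_div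
  have hlog := tendsto_log_two_mul_atTop
  have hlogpos := hlog.eventually_gt_atTop 0
  have hLpos := eventually_gt_atTop (0 : ℝ)
  have hinv : Tendsto (fun L : ℝ => 8 / Real.log (2 * L)) atTop (𝓝 0) :=
    tendsto_const_nhds.div_atTop hlog
  have hsε : Tendsto (fun L => s L / ε L) atTop (𝓝 0) := by
    have h1 := hinv.mul (tendsto_maxwellShift_div_log x)
    rw [zero_mul] at h1
    refine h1.congr' ?_
    filter_upwards [hlogpos, hLpos] with L h2 h3
    simp only [hs, hε]
    field_simp
    ring
  have hrε : Tendsto (fun L => r L / ε L) atTop (𝓝 1) := by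
    have h1 := ((tendsto_maxwellShift_div_log x).pow 2).const_mul 4
    rw [show (4 : ℝ) * (1 / 2) ^ 2 = 1 by norm_num] at h1
    refine h1.congr' ?_
    filter_upwards [hlogpos, hLpos] with L h2 h3
    simp only [hr, hε]
    field_simp
    ring
  have hδε : Tendsto (fun L => δ L / ε L) atTop (𝓝 0) := by
    have h1 : Tendsto (fun L : ℝ => 8 / Real.log (2 * L) ^ 2) atTop (𝓝 0) :=
      tendsto_const_nhds.div_atTop ((tendsto_pow_atTop two_ne_zero).comp hlog)
    refine tendsto_of_tendsto_of_tendsto_of_le_of_le' tendsto_const_nhds h1 ?_ ?_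
    all_goals
      filter_upwards [hlogpos, hLpos, eventually_sqrt_le_maxwellThreshold x] with L h2 h3 h4
      have h5 : 0 < Real.sqrt (2 * L) := Real.sqrt_pos.2 (by positivity)
      have h6 : 0 < maxwellThreshold x L := h5.trans_le h4
    · exact div_nonneg (maxwellTailRemainder_nonneg h6) (by positivity)
    · have h7 : δ L ≤ 1 / (2 * L) := by
        refine (maxwellTailRemainder_le h6).trans ?_
        rw [← Real.sq_sqrt (show 0 ≤ 2 * L by positivity)]
        gcongr
      calc δ L / ε L ≤ 1 / (2 * L) / ε L := by gcongr
        _ = 8 / Real.log (2 * L) ^ 2 := by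
          simp only [hε]
          field_simp
          norm_num
  have tendsto_of_div {f : ℝ → ℝ} {l : ℝ} (hf : Tendsto (fun L => f L / ε L) atTop (𝓝 l)) :
      Tendsto f atTop (𝓝 0) := by
    have h1 := hf.mul hε0
    rw [mul_zero] at h1
    refine h1.congr' ?_
    filter_upwards [hlogpos, hLpos] with L h2 h3
    refine div_mul_cancel₀ _ ?_
    positivity
  have hs0 := tendsto_of_div hsε
  have hr0 := tendsto_of_div hrε
  have hδ0 := tendsto_of_div hδε
  have hexp : Tendsto (fun L => (Real.exp (-r L) - 1) / ε L) atTop (𝓝 (-1)) := by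
    have h1 : ContinuousAt (dslope Real.exp 0) 0 :=
      continuousAt_dslope_same.2 Real.differentiableAt_exp
    have hnr : Tendsto (fun L => -r L) atTop (𝓝 0) := by simpa using hr0.neg
    have h2 := (h1.tendsto.comp hnr).mul hrε.neg
    rw [dslope_same, Real.deriv_exp, Real.exp_zero, one_mul] at h2
    refine h2.congr fun L => ?_
    have h3 := sub_smul_dslope Real.exp 0 (-r L)
    rw [Real.exp_zero, smul_eq_mul, sub_zero] at h3
    rw [← h3, Function.comp_apply]
    ring
  have hmain := ((((hs0.const_add 1).mul (hδ0.const_add 1)).mul hexp).add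
    ((hsε.add hδε).add (hs0.mul hδε))).const_mul (Real.exp (-x))
  simp only [add_zero, mul_one, mul_zero, mul_neg] at hmain
  refine hmain.congr' ?_
  filter_upwards [hLpos, eventually_sqrt_le_maxwellThreshold x] with L h3 h4
  have h6 : 0 < maxwellThreshold x L := (Real.sqrt_pos.2 (by positivity)).trans_le h4
  rw [exp_mul_one_sub_maxwellCdf hσ h3 h6]
  simp only [hr, hs, hδ]
  ring

theorem normalised_threshold_eq {σ : ℝ} (hσ : 0 < σ) (x L : ℝ) :
    σ / Real.sqrt (2 * L) * x + (Real.sqrt (2 * σ ^ 2 * L)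
      + σ * (Real.log (2 * L) + Real.log (2 / Real.pi)) / (2 * Real.sqrt (2 * L))) =
      σ * maxwellThreshold x L := by
  rw [show 2 * σ ^ 2 * L = σ ^ 2 * (2 * L) by ring,
    Real.sqrt_mul (sq_nonneg σ), Real.sqrt_sq hσ.le, maxwellThreshold, maxwellShift, mul_comm 2 (Real.sqrt _), ← div_div]
  ring

/-- Theorem 2.1 (Liu–Liu): pointwise rate of convergence of the Maxwell maximum
to the Gumbel limit. -/
theorem maxwell_extreme_convergence_rate (σ : ℝ) (hσ : 0 < σ) :
    ∀ x : ℝ, Filter.Tendsto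
      (fun n : ℕ =>
        ((maxwellCdf σ ((σ / Real.sqrt (2 * Real.log n)) * x
            + (Real.sqrt (2 * σ ^ 2 * Real.log n)
              + σ * (Real.log (2 * Real.log n) + Real.log (2 / Real.pi))
                / (2 * Real.sqrt (2 * Real.log n))))) ^ n
          - Real.exp (-Real.exp (-x)))
        / (Real.exp (-Real.exp (-x)) * Real.exp (-x)
            * (Real.log (2 * Real.log n)) ^ 2 / (16 * Real.log n)))
      Filter.atTop (nhds 1) := by
  intro x
  have hlogn : Tendsto (fun n : ℕ => Real.log n) atTop atTop :=
    Real.tendsto_log_atTop.comp tendsto_natCast_atTop_atTop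
  have hloglog := tendsto_log_two_mul_atTop.comp hlogn
  have hε : ∀ᶠ n : ℕ in atTop, 0 < Real.log (2 * Real.log n) ^ 2 / (16 * Real.log n) := by
    filter_upwards [hlogn.eventually_gt_atTop 0, hloglog.eventually_gt_atTop 0] with n h1 h2
    simp only [Function.comp_apply] at h2
    positivity
  have hnε : Tendsto (fun n : ℕ => n * (Real.log (2 * Real.log n) ^ 2 / (16 * Real.log n)))
      atTop atTop := by
    refine tendsto_atTop_mono' _ ?_
      (((tendsto_pow_atTop two_ne_zero).comp hloglog).atTop_div_const (show (0 : ℝ) < 16 by simp))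
    filter_upwards [hlogn.eventually_gt_atTop 0, eventually_gt_atTop 0] with n h1 h2
    have h3 : Real.log n ≤ n := Real.log_le_self n.cast_nonneg
    simp only [Function.comp_apply]
    rw [← mul_div_assoc, div_le_div_iff₀ (by positivity) (by positivity)]
    nlinarith [mul_le_mul_of_nonneg_right h3 (sq_nonneg (Real.log (2 * Real.log n)))]
  have htail : Tendsto (fun n : ℕ =>
      (n * (1 - maxwellCdf σ (σ * maxwellThreshold x (Real.log n))) - Real.exp (-x)) /
        (Real.log (2 * Real.log n) ^ 2 / (16 * Real.log n))) atTop (𝓝 (-Real.exp (-x))) := by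
    refine ((tendsto_exp_mul_one_sub_maxwellCdf_sub_div hσ x).comp hlogn).congr' ?_
    filter_upwards [eventually_gt_atTop 0] with n hn
    simp only [Function.comp_apply]
    rw [Real.exp_log (by exact_mod_cast hn)]
  have hpow := (tendsto_one_sub_pow_sub_exp_div hε
    (tendsto_log_two_mul_sq_div.comp hlogn) hnε htail).div_const
      (Real.exp (-Real.exp (-x)) * Real.exp (-x))
  rw [mul_neg, neg_neg, div_self (by positivity)] at hpow
  refine hpow.congr fun n => ?_
  rw [normalised_threshold_eq hσ, sub_sub_cancel, div_div]
  congr 1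
  ring
end
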